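/- arXiv:1311.0396 — 2 statements merged into one kernel-verified Lean document; each statement's English description precedes it below -/
import Mathlib

section
/- (Equation (4.2): off-policy derivative identity, constrained case.) Let Ω ⊆ ℝⁿ be open, let ν⁰ : ℝⁿ → ℝᵐ be continuous, and let V : ℝⁿ → ℝ be continuously differentiable, satisfying the constrained Lyapunov function equation with policy ν⁰ on Ω. Define v(x) = −(1/2)R⁻¹g(x)ᵀ∇V(x). Then for every control u : I → ℝᵐ and every trajectory x : I → Ω with control u, the function t ↦ V(x(t)) is differentiable on I with derivative d/dt V(x(t)) = −Q(x(t)) − W(φ(ν⁰(x(t)))) + 2 v(x(t))ᵀR(φ(ν⁰(x(t))) − u(t)) for all t ∈ I. -/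
open Matrix Set

/-- The gradient vector of a scalar function on `Fin n → ℝ`,
whose `j`-th component is the partial derivative in direction `j`. -/
noncomputable def gradVec {n : ℕ} (V : (Fin n → ℝ) → ℝ) (x : Fin n → ℝ) : Fin n → ℝ :=
  fun j => fderiv ℝ V x (Pi.single j 1)

/-- Componentwise application of the saturation function `φ`. -/
def phiVec {m : ℕ} (φ : ℝ → ℝ) (ν : Fin m → ℝ) : Fin m → ℝ := fun l => φ (ν l)

/-- The nonquadratic input penalty `W(v) = 2 ∑ l, r l ∫₀^{v l} ψ(μ) dμ`. -/
noncomputable def Wpen {m : ℕ} (r : Fin m → ℝ) (ψ : ℝ → ℝ) (v : Fin m → ℝ) : ℝ :=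
  2 * ∑ l, r l * ∫ μ in (0:ℝ)..(v l), ψ μ

theorem fderiv_eq_gradVec_dot {n : ℕ} (V : (Fin n → ℝ) → ℝ) (x w : Fin n → ℝ) :
    fderiv ℝ V x w = gradVec V x ⬝ᵥ w := by
  conv_lhs => rw [pi_eq_sum_univ' w]
  rw [map_sum]
  simp only [dotProduct, gradVec]
  refine Finset.sum_congr rfl fun j _ => ?_
  rw [map_smul, smul_eq_mul, mul_comm]

/-- **Equation (4.2): off-policy derivative identity, constrained case.** If `V` solves
the constrained Lyapunov function equation with policy `ν⁰` on `Ω` and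
`v = -(1/2) R⁻¹ gᵀ ∇V`, then along every trajectory in `Ω` with control `u`,
`d/dt V(x(t)) = -Q(x(t)) - W(φ(ν⁰(x(t)))) + 2 v(x(t))ᵀ R (φ(ν⁰(x(t))) - u(t))`. -/
theorem constrained_offpolicy_derivative_identity {n m : ℕ}
    (f : (Fin n → ℝ) → (Fin n → ℝ)) (g : (Fin n → ℝ) → Matrix (Fin n) (Fin m) ℝ)
    (hf : Continuous f) (hg : Continuous g)
    (Q : (Fin n → ℝ) → ℝ) (hQ : Continuous Q)
    (β : ℝ) (hβ : 0 < β)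
    (φ ψ : ℝ → ℝ) (hφc : Continuous φ) (hφmono : StrictMono φ)
    (hφodd : ∀ s : ℝ, φ (-s) = -φ s) (hφrange : Set.range φ = Ioo (-β) β)
    (hψ : ∀ s : ℝ, ψ (φ s) = s)
    (r : Fin m → ℝ) (hr : ∀ l, 0 < r l)
    (R : Matrix (Fin m) (Fin m) ℝ) (hR : R = Matrix.diagonal r)
    (Ω : Set (Fin n → ℝ)) (hΩ : IsOpen Ω)
    (ν₀ : (Fin n → ℝ) → (Fin m → ℝ)) (hν₀ : Continuous ν₀)
    (V : (Fin n → ℝ) → ℝ) (hV : ContDiff ℝ 1 V)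
    (hLFE : ∀ x ∈ Ω, gradVec V x ⬝ᵥ (f x + g x *ᵥ phiVec φ (ν₀ x)) + Q x
        + Wpen r ψ (phiVec φ (ν₀ x)) = 0)
    (v : (Fin n → ℝ) → (Fin m → ℝ))
    (hvdef : ∀ x, v x = (-(1/2) : ℝ) • (R⁻¹ *ᵥ ((g x)ᵀ *ᵥ gradVec V x))) :
    ∀ I : Set ℝ, I.OrdConnected →
      ∀ (u : ℝ → Fin m → ℝ) (x : ℝ → Fin n → ℝ),
        (∀ t ∈ I, x t ∈ Ω) →
        (∀ t ∈ I, HasDerivWithinAt x (f (x t) + g (x t) *ᵥ u t) I t) →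
        ∀ t ∈ I, HasDerivWithinAt (fun s => V (x s))
          (-Q (x t) - Wpen r ψ (phiVec φ (ν₀ (x t)))
            + 2 * (v (x t) ⬝ᵥ R *ᵥ (phiVec φ (ν₀ (x t)) - u t))) I t := by
  intro I _ u x hx hd t ht
  have h1 := ((hV.differentiable one_ne_zero) (x t)).hasFDerivAt.comp_hasDerivWithinAt t (hd t ht)
  refine h1.congr_deriv ?_
  rw [fderiv_eq_gradVec_dot]
  have h2 := hLFE (x t) (hx t ht)
  have hdet : IsUnit R.det := by
    rw [hR, Matrix.det_diagonal]
    exact (Finset.prod_pos fun l _ => hr l).ne'.isUnit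
  have hT : Rᵀ = R := by rw [hR, Matrix.diagonal_transpose]
  have key : ∀ w, v (x t) ⬝ᵥ R *ᵥ w = -(1/2) * (gradVec V (x t) ⬝ᵥ g (x t) *ᵥ w) := by
    intro w
    rw [Matrix.dotProduct_mulVec, ← Matrix.mulVec_transpose, hT, hvdef, Matrix.mulVec_smul,
      Matrix.mulVec_mulVec, Matrix.mul_nonsing_inv _ hdet, Matrix.one_mulVec,
      smul_dotProduct, smul_eq_mul, Matrix.mulVec_transpose, Matrix.dotProduct_mulVec]
  rw [key, Matrix.mulVec_sub, dotProduct_sub]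
  rw [dotProduct_add] at h2 ⊢
  linarith
end

section
/- (Equations (4.5)–(4.6): the integral equation implies the pointwise equation, constrained case.) Let Ω ⊆ ℝⁿ be open, let ν⁰ : ℝⁿ → ℝᵐ be continuous, let V : ℝⁿ → ℝ be continuously differentiable, and let v : Ω → ℝᵐ be continuous. Fix x₀ ∈ Ω and u₀ ∈ ℝᵐ, and suppose there exist ε > 0, a continuous control u : [0,ε) → ℝᵐ with u(0) = u₀, and a trajectory x : [0,ε) → Ω with control u and x(0) = x₀, such that (V, v) satisfies the constrained off-policy integral equation for this control and trajectory (for all 0 ≤ t ≤ t+Δt < ε). Then ∇V(x₀)ᵀ(f(x₀) + g(x₀)u₀) = 2 v(x₀)ᵀR(φ(ν⁰(x₀)) − u₀) − Q(x₀) − W(φ(ν⁰(x₀))). -/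
open Matrix Set

theorem aux_cont_prim (β : ℝ) (φ ψ : ℝ → ℝ) (hφc : Continuous φ) (hφmono : StrictMono φ)
    (hφodd : ∀ s : ℝ, φ (-s) = -φ s) (hφrange : Set.range φ = Ioo (-β) β)
    (hψ : ∀ s : ℝ, ψ (φ s) = s) : Continuous fun s => ∫ μ in (0:ℝ)..(φ s), ψ μ := by
  have h0 : φ 0 = 0 := by
    have := hφodd 0
    simp only [neg_zero] at this
    linarith
  rw [continuous_iff_continuousAt]
  intro s₀
  set c := |s₀| + 1 with hc
  have hc0 : 0 < c := by positivity
  have hab : φ (-c) ≤ φ c := hφmono.monotone (by linarith)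
  have hmono : MonotoneOn ψ (uIcc (φ (-c)) (φ c)) := by
    rw [uIcc_of_le hab]
    have hsub : Icc (φ (-c)) (φ c) ⊆ Set.range φ := by
      rw [hφrange]
      have h1 : φ (-c) ∈ Ioo (-β) β := hφrange ▸ mem_range_self _
      have h2 : φ c ∈ Ioo (-β) β := hφrange ▸ mem_range_self _
      intro y hy
      exact ⟨lt_of_lt_of_le h1.1 hy.1, lt_of_le_of_lt hy.2 h2.2⟩
    intro y hy z hz hyz
    obtain ⟨p, rfl⟩ := hsub hy
    obtain ⟨q, rfl⟩ := hsub hz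
    rw [hψ, hψ]
    exact hφmono.le_iff_le.mp hyz
  have hInteg : IntervalIntegrable ψ MeasureTheory.volume (φ (-c)) (φ c) := hmono.intervalIntegrable
  have hmem0 : (0:ℝ) ∈ uIcc (φ (-c)) (φ c) := by
    rw [uIcc_of_le hab]
    constructor
    · rw [← h0]; exact hφmono.monotone (by linarith)
    · rw [← h0]; exact hφmono.monotone (by linarith)
  have hco := intervalIntegral.continuousOn_primitive_interval' hInteg hmem0
  have hnh : uIcc (φ (-c)) (φ c) ∈ nhds (φ s₀) := by
    rw [uIcc_of_le hab]
    apply Icc_mem_nhds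
    · exact hφmono (by have := neg_abs_le s₀; linarith)
    · exact hφmono (by have := le_abs_self s₀; linarith)
  exact ContinuousAt.comp (f := φ) (hco.continuousAt hnh) hφc.continuousAt

theorem aux_deriv (h : ℝ → ℝ) (ε : ℝ) (hε : 0 < ε) (hh : ContinuousOn h (Ico 0 ε)) :
    HasDerivWithinAt (fun t => ∫ τ in (0:ℝ)..t, h τ) (h 0) (Ici 0) 0 := by
  have hcont : ContinuousWithinAt h (Ioi 0) 0 := by
    have h1 := (hh 0 ⟨le_rfl, hε⟩).mono (Ioo_subset_Ico_self)
    exact h1.mono_of_mem_nhdsWithin (Ioo_mem_nhdsGT hε)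
  apply intervalIntegral.integral_hasDerivWithinAt_right (t := Ioi 0) (by simp) _ hcont
  exact ⟨Ioo 0 ε, Ioo_mem_nhdsGT hε,
    (hh.mono Ioo_subset_Ico_self).aestronglyMeasurable measurableSet_Ioo⟩

theorem aux_grad {n : ℕ} (V : (Fin n → ℝ) → ℝ) (x w : Fin n → ℝ) :
    gradVec V x ⬝ᵥ w = fderiv ℝ V x w := by
  conv_rhs => rw [pi_eq_sum_univ' w, map_sum]
  unfold gradVec dotProduct
  refine Finset.sum_congr rfl fun j _ => ?_
  have : (fun i => if j = i then (1:ℝ) else 0) = Pi.single j 1 := by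
    ext i; simp [Pi.single_apply, eq_comm]
  simp [map_smul, mul_comm]

/-- **Equations (4.5)–(4.6): the integral equation implies the pointwise equation,
constrained case.** If `(V, v)` satisfies the constrained off-policy integral equation
along some trajectory starting at `x₀ ∈ Ω` with continuous control starting at `u₀`,
then `∇V(x₀)ᵀ(f(x₀)+g(x₀)u₀) = 2 v(x₀)ᵀ R (φ(ν⁰(x₀)) - u₀) - Q(x₀) - W(φ(ν⁰(x₀)))`. -/
theorem constrained_integral_implies_pointwise {n m : ℕ}
    (f : (Fin n → ℝ) → (Fin n → ℝ)) (g : (Fin n → ℝ) → Matrix (Fin n) (Fin m) ℝ)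
    (hf : Continuous f) (hg : Continuous g)
    (Q : (Fin n → ℝ) → ℝ) (hQ : Continuous Q)
    (β : ℝ) (hβ : 0 < β)
    (φ ψ : ℝ → ℝ) (hφc : Continuous φ) (hφmono : StrictMono φ)
    (hφodd : ∀ s : ℝ, φ (-s) = -φ s) (hφrange : Set.range φ = Ioo (-β) β)
    (hψ : ∀ s : ℝ, ψ (φ s) = s)
    (r : Fin m → ℝ) (hr : ∀ l, 0 < r l)
    (R : Matrix (Fin m) (Fin m) ℝ) (hR : R = Matrix.diagonal r)
    (Ω : Set (Fin n → ℝ)) (hΩ : IsOpen Ω)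
    (ν₀ : (Fin n → ℝ) → (Fin m → ℝ)) (hν₀ : Continuous ν₀)
    (V : (Fin n → ℝ) → ℝ) (hV : ContDiff ℝ 1 V)
    (v : (Fin n → ℝ) → (Fin m → ℝ)) (hv : ContinuousOn v Ω)
    (x₀ : Fin n → ℝ) (hx₀ : x₀ ∈ Ω) (u₀ : Fin m → ℝ)
    (hex : ∃ ε > (0:ℝ), ∃ u : ℝ → (Fin m → ℝ), ∃ x : ℝ → (Fin n → ℝ),
      ContinuousOn u (Ico 0 ε) ∧ u 0 = u₀ ∧
      x 0 = x₀ ∧ (∀ t ∈ Ico (0:ℝ) ε, x t ∈ Ω) ∧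
      (∀ t ∈ Ico (0:ℝ) ε, HasDerivWithinAt x (f (x t) + g (x t) *ᵥ u t) (Ico 0 ε) t) ∧
      (∀ t ∈ Ico (0:ℝ) ε, ∀ Δt ≥ (0:ℝ), t + Δt ∈ Ico (0:ℝ) ε →
        V (x t) - V (x (t + Δt))
            + 2 * ∫ τ in t..(t + Δt), v (x τ) ⬝ᵥ R *ᵥ (phiVec φ (ν₀ (x τ)) - u τ)
          = ∫ τ in t..(t + Δt), (Q (x τ) + Wpen r ψ (phiVec φ (ν₀ (x τ)))))) :
    gradVec V x₀ ⬝ᵥ (f x₀ + g x₀ *ᵥ u₀)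
      = 2 * (v x₀ ⬝ᵥ R *ᵥ (phiVec φ (ν₀ x₀) - u₀)) - Q x₀
        - Wpen r ψ (phiVec φ (ν₀ x₀)) := by
  obtain ⟨ε, hε, u, x, hu, hu0, hx0, hxΩ, hxd, heq⟩ := hex
  have hxc : ContinuousOn x (Ico 0 ε) := fun t ht => (hxd t ht).continuousWithinAt
  have h0 : (0:ℝ) ∈ Ico 0 ε := ⟨le_rfl, hε⟩
  have hWc : Continuous fun y => Wpen r ψ (phiVec φ (ν₀ y)) := by
    unfold Wpen phiVec
    have hp := aux_cont_prim β φ ψ hφc hφmono hφodd hφrange hψ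
    refine continuous_const.mul (continuous_finsetSum _ fun l _ => continuous_const.mul ?_)
    exact hp.comp ((continuous_apply l).comp hν₀)
  have hPc : Continuous fun y => phiVec φ (ν₀ y) := by
    unfold phiVec
    exact continuous_pi fun l => hφc.comp ((continuous_apply l).comp hν₀)
  have h1c : ContinuousOn (fun τ => v (x τ) ⬝ᵥ R *ᵥ (phiVec φ (ν₀ (x τ)) - u τ)) (Ico 0 ε) := by
    have ha : ContinuousOn (fun τ => v (x τ)) (Ico 0 ε) := hv.comp hxc hxΩ
    have hb : ContinuousOn (fun τ => phiVec φ (ν₀ (x τ)) - u τ) (Ico 0 ε) :=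
      (hPc.comp_continuousOn hxc).sub hu
    have hk : Continuous fun p : (Fin m → ℝ) × (Fin m → ℝ) => p.1 ⬝ᵥ R *ᵥ p.2 :=
      continuous_fst.dotProduct (continuous_const.matrix_mulVec continuous_snd)
    exact hk.comp_continuousOn (ha.prodMk hb)
  have h2c : ContinuousOn (fun τ => Q (x τ) + Wpen r ψ (phiVec φ (ν₀ (x τ)))) (Ico 0 ε) :=
    (hQ.add hWc).comp_continuousOn hxc
  have hd1 := aux_deriv _ ε hε h1c
  have hd2 := aux_deriv _ ε hε h2c
  have hd3 := (((hd1.const_mul 2).sub hd2).const_add (V (x 0))).mono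
    (Ico_subset_Ici_self : Ico 0 ε ⊆ Ici 0)
  have hVd : HasFDerivAt V (fderiv ℝ V (x 0)) (x 0) :=
    (hV.differentiable (by norm_num) (x 0)).hasFDerivAt
  have hd4 := hVd.comp_hasDerivWithinAt (0:ℝ) (hxd 0 h0)
  have hd5 := hd3.congr_of_mem (f₁ := V ∘ x) (fun t ht => by
    have := heq 0 h0 t ht.1 (by simpa using ht)
    simp only [zero_add] at this
    simp only [Function.comp, Pi.sub_apply]
    linarith) h0
  have hun : UniqueDiffWithinAt ℝ (Ico (0:ℝ) ε) 0 := uniqueDiffOn_Ico 0 ε 0 h0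
  have hfin := hun.eq_deriv _ hd4 hd5
  rw [aux_grad]
  subst hx0 hu0
  rw [hfin]
  ring
end
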